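/- arXiv:2506.02982 — 3 statements merged into one kernel-verified Lean document; each statement's English description precedes it below -/
import Mathlib

section
/- (Asymptotic number of unbounded aperiodic bridges.) Suppose the walk is aperiodic, i.e. gcd{j + c : j ∈ S} = 1. Then the weighted number of bridges V_n satisfies V_n ∼ λ₀ · P(τ)ⁿ / √(2πn) as n → ∞, where λ₀ = (1/τ)·√(P(τ)/P''(τ)); that is, the quotient V_n · τ · √(P''(τ)) · √(2πn) / (√(P(τ)) · P(τ)ⁿ) tends to 1 as n → ∞. -/
open Filter

/-- The trigonometric polynomial `t ↦ ∑ q_j e^{ijt}`; for a probability vector `q` this is its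
characteristic function. -/
noncomputable def trigSum (S : Finset ℤ) (q : ℤ → ℝ) (t : ℝ) : ℂ :=
  ∑ j ∈ S, (q j : ℂ) * Complex.exp (t * j * Complex.I)

theorem continuous_trigSum (S : Finset ℤ) (q : ℤ → ℝ) : Continuous (trigSum S q) := by
  unfold trigSum
  fun_prop

theorem trigSum_pow (S : Finset ℤ) (q : ℤ → ℝ) (t : ℝ) (n : ℕ) :
    trigSum S q t ^ n = ∑ s ∈ Fintype.piFinset fun _ : Fin n => S,
      ((∏ i, q (s i) : ℝ) : ℂ) * Complex.exp (t * ((∑ i, s i : ℤ) : ℂ) * Complex.I) := by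
  rw [← Fin.prod_const, trigSum, Finset.prod_univ_sum]
  refine Finset.sum_congr rfl fun s _ => ?_
  rw [Finset.prod_mul_distrib, ← Complex.exp_sum]
  push_cast
  rw [Finset.mul_sum, Finset.sum_mul]

theorem integral_exp_int_mul_I (k : ℤ) :
    ∫ t in (-Real.pi)..Real.pi, Complex.exp (t * k * Complex.I)
      = if k = 0 then ((2 * Real.pi : ℝ) : ℂ) else 0 := by
  split_ifs with hk
  · subst hk
    simp
    ring
  · have hk' : (k : ℂ) * Complex.I ≠ 0 := by simp [hk]
    have h := integral_exp_mul_complex (a := -Real.pi) (b := Real.pi) hk'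
    have h2 : Complex.exp (k * Complex.I * (Real.pi : ℂ))
        = Complex.exp (k * Complex.I * ((-Real.pi : ℝ) : ℂ)) := by
      rw [Complex.exp_eq_exp_iff_exists_int]
      exact ⟨k, by push_cast; ring⟩
    rw [h2, sub_self, zero_div] at h
    rw [← h]
    refine intervalIntegral.integral_congr fun t _ => ?_
    congr 1
    ring

theorem integral_trigSum_pow (S : Finset ℤ) (q : ℤ → ℝ) (n : ℕ) :
    ∫ t in (-Real.pi)..Real.pi, trigSum S q t ^ n
      = ((2 * Real.pi * ∑ s ∈ (Fintype.piFinset fun _ : Fin n => S).filter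
        (fun s => ∑ i, s i = 0), ∏ i, q (s i) : ℝ) : ℂ) := by
  simp_rw [trigSum_pow]
  rw [intervalIntegral.integral_finsetSum fun s _ =>
    (by fun_prop : Continuous _).intervalIntegrable _ _]
  simp_rw [intervalIntegral.integral_const_mul, integral_exp_int_mul_I]
  push_cast
  rw [Finset.mul_sum, Finset.sum_filter]
  refine Finset.sum_congr rfl fun s _ => ?_
  split_ifs <;> simp [mul_comm]

theorem tendsto_nat_mul_exp_div_sqrt_sub (y : ℂ) :
    Tendsto (fun n : ℕ => (n : ℂ) * (Complex.exp (y / (√(n : ℝ) : ℝ)) - 1 - y / (√(n : ℝ) : ℝ)))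
      atTop (nhds (y ^ 2 / 2)) := by
  have hs : Tendsto (fun n : ℕ => √(n : ℝ)) atTop atTop :=
    Real.tendsto_sqrt_atTop.comp tendsto_natCast_atTop_atTop
  rw [← tendsto_sub_nhds_zero_iff]
  refine squeeze_zero_norm' (a := fun n : ℕ => ‖y‖ ^ 3 / √(n : ℝ)) ?_
    (tendsto_const_nhds.div_atTop hs)
  filter_upwards [hs.eventually_ge_atTop ‖y‖, hs.eventually_gt_atTop 0] with n hn hn0
  have hz : ‖y / (√(n : ℝ) : ℝ)‖ ≤ 1 := by
    rw [norm_div, Complex.norm_real, Real.norm_of_nonneg hn0.le]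
    exact (div_le_one hn0).2 hn
  have hb := Complex.exp_bound hz (n := 3) (by norm_num)
  have hnn : (n : ℂ) = ((√(n : ℝ) : ℝ) : ℂ) ^ 2 := by
    rw [← Complex.ofReal_pow, Real.sq_sqrt (Nat.cast_nonneg n), Complex.ofReal_natCast]
  have hn0' : ((√(n : ℝ) : ℝ) : ℂ) ≠ 0 := by exact_mod_cast hn0.ne'
  simp only [Finset.sum_range_succ, Finset.sum_range_zero, norm_div, Complex.norm_real,
    Real.norm_of_nonneg hn0.le] at hb
  norm_num [Nat.factorial] at hb
  set r := √(n : ℝ)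
  rw [hnn]
  have heq : ((r : ℝ) : ℂ) ^ 2 * (Complex.exp (y / r) - 1 - y / r) - y ^ 2 / 2
      = (r : ℂ) ^ 2 * (Complex.exp (y / r) - (1 + y / r + (y / r) ^ 2 / 2)) := by
    field_simp
    ring
  rw [heq, norm_mul, norm_pow, Complex.norm_real, Real.norm_of_nonneg hn0.le]
  calc r ^ 2 * _ ≤ r ^ 2 * ((‖y‖ / r) ^ 3 * (2 / 9)) := by gcongr
    _ = (‖y‖ ^ 3 / r) * (2 / 9) := by field_simp
    _ ≤ (‖y‖ ^ 3 / r) * 1 := by gcongr; norm_num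
    _ = _ := mul_one _

theorem tendsto_trigSum_div_sqrt_pow {S : Finset ℤ} {q : ℤ → ℝ} (h1 : ∑ j ∈ S, q j = 1)
    (h0 : ∑ j ∈ S, q j * j = 0) (x : ℝ) :
    Tendsto (fun n : ℕ => trigSum S q (x / √(n : ℝ)) ^ n) atTop
      (nhds ((Real.exp (-((∑ j ∈ S, q j * j ^ 2) / 2) * x ^ 2) : ℝ) : ℂ)) := by
  have hg : Tendsto (fun n : ℕ => (n : ℂ) * (trigSum S q (x / √(n : ℝ)) - 1)) atTop
      (nhds (((-((∑ j ∈ S, q j * j ^ 2) / 2) * x ^ 2 : ℝ) : ℂ))) := by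
    have h := tendsto_finsetSum S fun j _ =>
      (tendsto_nat_mul_exp_div_sqrt_sub (x * j * Complex.I)).const_mul (q j : ℂ)
    convert h using 1
    · ext n
      have h1' : ∑ j ∈ S, (q j : ℂ) = 1 := by exact_mod_cast h1
      have h0' : ∑ j ∈ S, (q j : ℂ) * j = 0 := by exact_mod_cast h0
      have e : ∑ j ∈ S, (q j : ℂ) * (x * j * Complex.I / (√(n : ℝ) : ℝ)) = 0 := by
        rw [← mul_zero (x * Complex.I / (√(n : ℝ) : ℝ)), ← h0', Finset.mul_sum]
        exact Finset.sum_congr rfl fun j _ => by ring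
      calc (n : ℂ) * (trigSum S q (x / √(n : ℝ)) - 1)
          = n * (trigSum S q (x / √(n : ℝ)) - ∑ j ∈ S, (q j : ℂ)
            - ∑ j ∈ S, (q j : ℂ) * (x * j * Complex.I / (√(n : ℝ) : ℝ))) := by
            rw [h1', e, sub_zero]
        _ = _ := by
            rw [trigSum, ← Finset.sum_sub_distrib, ← Finset.sum_sub_distrib, Finset.mul_sum]
            refine Finset.sum_congr rfl fun j _ => ?_
            rw [show ((x / √(n : ℝ) : ℝ) : ℂ) * j * Complex.I
              = x * j * Complex.I / (√(n : ℝ) : ℝ) by push_cast; ring]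
            ring
    · congr 1
      push_cast
      rw [Finset.sum_div, ← Finset.sum_neg_distrib, Finset.sum_mul]
      refine Finset.sum_congr rfl fun j _ => ?_
      rw [mul_pow, Complex.I_sq]
      ring
  have := Complex.tendsto_one_add_pow_exp_of_tendsto hg
  rw [Complex.ofReal_exp]
  simpa using this

theorem normSq_trigSum (S : Finset ℤ) (q : ℤ → ℝ) (t : ℝ) :
    Complex.normSq (trigSum S q t)
      = ∑ k ∈ S, ∑ j ∈ S, q k * q j * Real.cos ((j - k) * t) := by
  have hre : (trigSum S q t).re = ∑ j ∈ S, q j * Real.cos (t * j) := by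
    simp [trigSum, Complex.re_sum, Complex.exp_re]
  have him : (trigSum S q t).im = ∑ j ∈ S, q j * Real.sin (t * j) := by
    simp [trigSum, Complex.im_sum, Complex.exp_im]
  rw [Complex.normSq_apply, hre, him, Finset.sum_mul_sum, Finset.sum_mul_sum,
    ← Finset.sum_add_distrib]
  refine Finset.sum_congr rfl fun k _ => ?_
  rw [← Finset.sum_add_distrib]
  refine Finset.sum_congr rfl fun j _ => ?_
  rw [show ((j : ℝ) - k) * t = t * j - t * k by ring, Real.cos_sub]
  ring

theorem abs_sin_nat_mul_le (n : ℕ) (x : ℝ) : |Real.sin (n * x)| ≤ n * |Real.sin x| := by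
  induction n with
  | zero => simp
  | succ n ih =>
    push_cast
    rw [add_mul, one_mul, Real.sin_add]
    calc _ ≤ |Real.sin (n * x) * Real.cos x| + |Real.cos (n * x) * Real.sin x| := abs_add_le _ _
      _ ≤ |Real.sin (n * x)| * 1 + 1 * |Real.sin x| := by
        rw [abs_mul, abs_mul]
        gcongr <;> exact Real.abs_cos_le_one _
      _ ≤ _ := by linarith

theorem abs_sin_int_mul_le (n : ℤ) (x : ℝ) : |Real.sin (n * x)| ≤ |(n : ℝ)| * |Real.sin x| := by
  rcases n.natAbs_eq with h | h <;> rw [h] <;>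
    simpa using abs_sin_nat_mul_le n.natAbs x

theorem abs_sin_sum_le {ι : Type*} (S : Finset ι) (f : ι → ℝ) :
    |Real.sin (∑ i ∈ S, f i)| ≤ ∑ i ∈ S, |Real.sin (f i)| := by
  classical
  induction S using Finset.induction_on with
  | empty => simp
  | insert a S ha ih =>
    rw [Finset.sum_insert ha, Finset.sum_insert ha, Real.sin_add]
    calc _ ≤ |Real.sin (f a) * Real.cos (∑ i ∈ S, f i)|
          + |Real.cos (f a) * Real.sin (∑ i ∈ S, f i)| := abs_add_le _ _
      _ ≤ |Real.sin (f a)| * 1 + 1 * |Real.sin (∑ i ∈ S, f i)| := by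
        rw [abs_mul, abs_mul]
        gcongr <;> exact Real.abs_cos_le_one _
      _ ≤ _ := by linarith

theorem exists_sq_le_sum_sin_sq {S : Finset ℤ} {m : ℤ} (hS : S.gcd (fun j => j - m) = 1) :
    ∃ C > 0, ∀ t : ℝ, |t| ≤ Real.pi →
      t ^ 2 ≤ C * ∑ j ∈ S, Real.sin ((j - m) * (t / 2)) ^ 2 := by
  obtain ⟨a, ha⟩ := Finset.gcd_eq_sum_mul S fun j => j - m
  rw [hS] at ha
  refine ⟨Real.pi ^ 2 * (∑ j ∈ S, |(a j : ℝ)| ^ 2 + 1), by positivity, fun t ht => ?_⟩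
  have hsin : |Real.sin (t / 2)| ≤ ∑ j ∈ S, |(a j : ℝ)| * |Real.sin ((j - m) * (t / 2))| := by
    have e : t / 2 = ∑ j ∈ S, (a j : ℝ) * ((j - m) * (t / 2)) := by
      have ha' : (1 : ℝ) = ∑ j ∈ S, ((j : ℝ) - m) * a j := by exact_mod_cast ha
      calc t / 2 = (∑ j ∈ S, ((j : ℝ) - m) * a j) * (t / 2) := by rw [← ha', one_mul]
        _ = _ := by
          rw [Finset.sum_mul]
          exact Finset.sum_congr rfl fun j _ => by ring
    rw [congrArg Real.sin e]
    exact (abs_sin_sum_le _ _).trans (Finset.sum_le_sum fun j _ => abs_sin_int_mul_le _ _)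
  have hjordan : |t| ≤ Real.pi * |Real.sin (t / 2)| := by
    have h := Real.mul_le_sin (x := |t| / 2) (by positivity) (by linarith)
    have h2 : Real.sin (|t| / 2) ≤ |Real.sin (t / 2)| := by
      rcases abs_choice t with h | h <;> rw [h]
      · exact le_abs_self _
      · rw [neg_div, Real.sin_neg]
        exact neg_le_abs _
    have h3 : Real.pi * (2 / Real.pi * (|t| / 2)) = |t| := by field_simp
    rw [← h3]
    gcongr
    exact h.trans h2
  have hcs := Finset.sum_mul_sq_le_sq_mul_sq S (fun j => |(a j : ℝ)|)
    (fun j => |Real.sin ((j - m) * (t / 2))|)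
  simp only [sq_abs] at hcs ⊢
  have hnn : 0 ≤ ∑ j ∈ S, Real.sin ((j - m) * (t / 2)) ^ 2 := by positivity
  calc t ^ 2 = |t| ^ 2 := (sq_abs t).symm
    _ ≤ (Real.pi * ∑ j ∈ S, |(a j : ℝ)| * |Real.sin ((j - m) * (t / 2))|) ^ 2 := by
      gcongr
      exact hjordan.trans (by gcongr)
    _ ≤ Real.pi ^ 2 * ((∑ j ∈ S, (a j : ℝ) ^ 2)
        * ∑ j ∈ S, Real.sin ((j - m) * (t / 2)) ^ 2) := by
      rw [mul_pow]
      gcongr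
    _ ≤ _ := by
      rw [mul_assoc]
      gcongr
      linarith

theorem exists_norm_trigSum_le {S : Finset ℤ} {q : ℤ → ℝ} (hq : ∀ j ∈ S, 0 < q j)
    (h1 : ∑ j ∈ S, q j = 1) {m : ℤ} (hm : m ∈ S) (hS : S.gcd (fun j => j - m) = 1) :
    ∃ κ > 0, ∀ t : ℝ, |t| ≤ Real.pi → ‖trigSum S q t‖ ≤ Real.exp (-κ * t ^ 2) := by
  obtain ⟨C, hC, hb⟩ := exists_sq_le_sum_sin_sq hS
  obtain ⟨k, hk, hmin⟩ := S.exists_min_image q ⟨m, hm⟩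
  have hqm := hq m hm
  have hqk := hq k hk
  refine ⟨q m * q k / C, by positivity, fun t ht => ?_⟩
  have hdef : 1 - Complex.normSq (trigSum S q t)
      = ∑ k ∈ S, ∑ j ∈ S, 2 * q k * q j * Real.sin ((j - k) * (t / 2)) ^ 2 := by
    have hone : (1 : ℝ) = ∑ k ∈ S, ∑ j ∈ S, q k * q j := by
      rw [← Finset.sum_mul_sum, h1, one_mul]
    rw [normSq_trigSum]
    nth_rewrite 1 [hone]
    rw [← Finset.sum_sub_distrib]
    refine Finset.sum_congr rfl fun k _ => ?_
    rw [← Finset.sum_sub_distrib]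
    refine Finset.sum_congr rfl fun j _ => ?_
    rw [show ((j : ℝ) - k) * t = 2 * ((j - k) * (t / 2)) by ring, Real.cos_two_mul,
      Real.cos_sq']
    ring
  have hrow : 2 * q m * q k * ∑ j ∈ S, Real.sin ((j - m) * (t / 2)) ^ 2
      ≤ 1 - Complex.normSq (trigSum S q t) := by
    rw [hdef, Finset.mul_sum]
    refine le_trans (Finset.sum_le_sum fun j hj => ?_) (Finset.single_le_sum (f := fun k =>
      ∑ j ∈ S, 2 * q k * q j * Real.sin ((j - k) * (t / 2)) ^ 2) (fun i hi => ?_) hm)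
    · have := hmin j hj
      gcongr
    · refine Finset.sum_nonneg fun j hj => ?_
      have := hq i hi
      have := hq j hj
      positivity
  have hsq : ‖trigSum S q t‖ ^ 2 ≤ 1 - 2 * (q m * q k / C * t ^ 2) := by
    rw [← Complex.normSq_eq_norm_sq]
    have : q m * q k / C * t ^ 2 ≤ q m * q k * ∑ j ∈ S, Real.sin ((j - m) * (t / 2)) ^ 2 := by
      rw [div_mul_eq_mul_div, div_le_iff₀ hC]
      nlinarith [mul_le_mul_of_nonneg_left (hb t ht) (mul_pos hqm hqk).le]
    linarith
  refine le_of_sq_le_sq ?_ (Real.exp_pos _).le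
  rw [← Real.exp_nat_mul]
  refine hsq.trans ?_
  have := Real.add_one_le_exp ((2 : ℕ) * (-(q m * q k / C) * t ^ 2))
  push_cast at this ⊢
  linarith

theorem tendsto_sqrt_mul_integral_trigSum_pow {S : Finset ℤ} {q : ℤ → ℝ}
    (hq : ∀ j ∈ S, 0 < q j) (h1 : ∑ j ∈ S, q j = 1) (h0 : ∑ j ∈ S, q j * j = 0)
    {m : ℤ} (hm : m ∈ S) (hS : S.gcd (fun j => j - m) = 1) :
    Tendsto (fun n : ℕ => ((√(n : ℝ) : ℝ) : ℂ) * ∫ t in (-Real.pi)..Real.pi, trigSum S q t ^ n)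
      atTop (nhds ((√(Real.pi / ((∑ j ∈ S, q j * j ^ 2) / 2)) : ℝ) : ℂ)) := by
  obtain ⟨κ, hκ, hb⟩ := exists_norm_trigSum_le hq h1 hm hS
  have hs : Tendsto (fun n : ℕ => √(n : ℝ)) atTop atTop :=
    Real.tendsto_sqrt_atTop.comp tendsto_natCast_atTop_atTop
  rw [← integral_gaussian, ← integral_complex_ofReal]
  have hdct : Tendsto (fun n : ℕ => ∫ x : ℝ,
      (Set.Ioc (-Real.pi * √(n : ℝ)) (Real.pi * √(n : ℝ))).indicator
        (fun x => trigSum S q (x / √(n : ℝ)) ^ n) x) atTop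
      (nhds (∫ x : ℝ, ((Real.exp (-((∑ j ∈ S, q j * j ^ 2) / 2) * x ^ 2) : ℝ) : ℂ))) := by
    refine MeasureTheory.tendsto_integral_filter_of_dominated_convergence
      (fun x => Real.exp (-κ * x ^ 2)) ?_ ?_ (integrable_exp_neg_mul_sq hκ) ?_
    · refine Eventually.of_forall fun n => ?_
      have hc : Continuous fun x : ℝ => trigSum S q (x / √(n : ℝ)) ^ n :=
        ((continuous_trigSum S q).comp (continuous_id.div_const _)).pow n
      exact hc.aestronglyMeasurable.indicator measurableSet_Ioc
    · filter_upwards [hs.eventually_gt_atTop 0] with n hn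
      refine Eventually.of_forall fun x => ?_
      by_cases hx : x ∈ Set.Ioc (-Real.pi * √(n : ℝ)) (Real.pi * √(n : ℝ))
      · rw [Set.indicator_of_mem hx, norm_pow]
        have hx' : |x / √(n : ℝ)| ≤ Real.pi := by
          rw [abs_le, le_div_iff₀ hn, div_le_iff₀ hn]
          exact ⟨hx.1.le, hx.2⟩
        calc _ ≤ Real.exp (-κ * (x / √(n : ℝ)) ^ 2) ^ n := by
              gcongr
              exact hb _ hx'
          _ = Real.exp (-κ * x ^ 2) := by
              rw [← Real.exp_nat_mul, div_pow, Real.sq_sqrt (Nat.cast_nonneg n)]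
              have : (n : ℝ) ≠ 0 := (Real.sqrt_pos.1 hn).ne'
              congr 1
              field_simp
      · rw [Set.indicator_of_notMem hx, norm_zero]
        positivity
    · refine Eventually.of_forall fun x => ?_
      refine (tendsto_trigSum_div_sqrt_pow h1 h0 x).congr' ?_
      filter_upwards [(hs.const_mul_atTop Real.pi_pos).eventually_gt_atTop |x|] with n hn
      rw [Set.indicator_of_mem]
      rw [abs_lt] at hn
      exact ⟨by linarith, hn.2.le⟩
  refine hdct.congr' ?_
  filter_upwards [hs.eventually_gt_atTop 0] with n hn
  rw [MeasureTheory.integral_indicator measurableSet_Ioc,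
    ← intervalIntegral.integral_of_le (by nlinarith [Real.pi_pos]),
    intervalIntegral.integral_comp_div (fun x => trigSum S q x ^ n) hn.ne',
    mul_div_cancel_right₀ _ hn.ne', mul_div_cancel_right₀ _ hn.ne', Complex.real_smul]

/-- Local central limit theorem at the origin for a centred, aperiodic, finitely supported
probability vector on `ℤ`. -/
theorem tendsto_sqrt_mul_bridge_sum {S : Finset ℤ} {q : ℤ → ℝ}
    (hq : ∀ j ∈ S, 0 < q j) (h1 : ∑ j ∈ S, q j = 1) (h0 : ∑ j ∈ S, q j * j = 0)
    {m : ℤ} (hm : m ∈ S) (hS : S.gcd (fun j => j - m) = 1)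
    (hvar : 0 < ∑ j ∈ S, q j * j ^ 2) :
    Tendsto (fun n : ℕ => (∑ s ∈ (Fintype.piFinset fun _ : Fin n => S).filter
        (fun s => ∑ i, s i = 0), ∏ i, q (s i)) * √(∑ j ∈ S, q j * j ^ 2)
          * √(2 * Real.pi * n)) atTop (nhds 1) := by
  have h := tendsto_sqrt_mul_integral_trigSum_pow hq h1 h0 hm hS
  simp_rw [integral_trigSum_pow, ← Complex.ofReal_mul] at h
  rw [Filter.tendsto_ofReal_iff] at h
  set v := ∑ j ∈ S, q j * j ^ 2
  have hpi := Real.pi_pos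
  have hlim : √(Real.pi / (v / 2)) * (√v * √(2 * Real.pi) / (2 * Real.pi)) = 1 := by
    rw [← mul_div_assoc, ← mul_assoc, ← Real.sqrt_mul (by positivity),
      ← Real.sqrt_mul (by positivity),
      show Real.pi / (v / 2) * v * (2 * Real.pi) = (2 * Real.pi) ^ 2 by field_simp,
      Real.sqrt_sq (by positivity), div_self (by positivity)]
  rw [← hlim]
  refine (h.mul_const _).congr fun n => ?_
  rw [Real.sqrt_mul (by positivity : (0 : ℝ) ≤ 2 * Real.pi)]
  field_simp

theorem prod_zpow_eq_zpow_sum {ι : Type*} (s : Finset ι) (f : ι → ℤ) {a : ℝ} (ha : a ≠ 0) :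
    ∏ i ∈ s, a ^ f i = a ^ ∑ i ∈ s, f i := by
  classical
  induction s using Finset.induction_on with
  | empty => simp
  | insert i s hi ih => rw [Finset.prod_insert hi, Finset.sum_insert hi, zpow_add₀ ha, ih]

theorem hasDerivAt_sum_zpow (S : Finset ℤ) (a : ℤ → ℝ) {u : ℝ} (hu : u ≠ 0) :
    HasDerivAt (fun u => ∑ j ∈ S, a j * u ^ j) (∑ j ∈ S, a j * (j * u ^ (j - 1))) u :=
  HasDerivAt.fun_sum fun j _ => (hasDerivAt_zpow j u (Or.inl hu)).const_mul (a j)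

/-- Asymptotic number of unbounded aperiodic bridges:
`V_n ∼ (1/τ)·√(P(τ)/P''(τ)) · P(τ)^n / √(2πn)`, stated as the quotient
`V_n · τ · √(P''(τ)) · √(2πn) / (√(P(τ)) · P(τ)^n) → 1`. -/
theorem stmt4
    (S : Finset ℤ) (hne : S.Nonempty)
    (hmin : S.min' hne < 0) (hmax : 0 < S.max' hne)
    (p : ℤ → ℝ) (hp : ∀ j ∈ S, 0 < p j)
    (c : ℤ) (hc : c = -S.min' hne)
    (haper : S.gcd (fun j => j + c) = 1)
    (P : ℝ → ℝ) (hP : ∀ u : ℝ, P u = ∑ j ∈ S, p j * u ^ j)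
    (τ : ℝ) (hτ : 0 < τ) (hτ' : deriv P τ = 0)
    (V : ℕ → ℝ)
    (hV : ∀ n : ℕ, V n = ∑ s ∈ (Fintype.piFinset fun _ : Fin n => S).filter
        (fun s => ∑ i, s i = 0), ∏ i, p (s i)) :
    Tendsto (fun n : ℕ =>
        V n * τ * Real.sqrt (deriv (deriv P) τ) * Real.sqrt (2 * Real.pi * n) /
          (Real.sqrt (P τ) * P τ ^ n)) atTop (nhds 1) := by
  have hderiv : ∀ u : ℝ, u ≠ 0 → deriv P u = ∑ j ∈ S, p j * (j * u ^ (j - 1)) := fun u hu => by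
    rw [funext hP]
    exact (hasDerivAt_sum_zpow S p hu).deriv
  have hderiv2 : deriv (deriv P) τ = ∑ j ∈ S, p j * (j * ((j - 1) * τ ^ (j - 2))) := by
    have hev : deriv P =ᶠ[nhds τ] fun u => ∑ j ∈ S, p j * (j * u ^ (j - 1)) := by
      filter_upwards [eventually_ne_nhds hτ.ne'] with u hu using hderiv u hu
    rw [hev.deriv_eq]
    refine HasDerivAt.deriv (HasDerivAt.fun_sum fun j _ => ?_)
    have h := (((hasDerivAt_zpow (j - 1) τ (Or.inl hτ.ne')).const_mul (j : ℝ)).const_mul (p j))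
    rw [show j - 1 - 1 = j - 2 by ring] at h
    exact_mod_cast h
  have hPpos : 0 < P τ := by
    rw [hP]
    exact Finset.sum_pos (fun j hj => mul_pos (hp j hj) (zpow_pos hτ j)) hne
  have hmean : ∑ j ∈ S, p j * τ ^ j * j = 0 := by
    rw [hderiv τ hτ.ne'] at hτ'
    rw [← mul_zero τ, ← hτ', Finset.mul_sum]
    refine Finset.sum_congr rfl fun j _ => ?_
    rw [zpow_sub_one₀ hτ.ne']
    field_simp
  have hsecond : ∑ j ∈ S, p j * τ ^ j * j ^ 2 = τ ^ 2 * deriv (deriv P) τ := by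
    rw [hderiv2, ← add_zero (τ ^ 2 * _), ← hmean, Finset.mul_sum, ← Finset.sum_add_distrib]
    refine Finset.sum_congr rfl fun j _ => ?_
    rw [zpow_sub₀ hτ.ne', zpow_ofNat]
    field_simp
    ring
  have hq : ∀ j ∈ S, 0 < p j * τ ^ j / P τ := fun j hj =>
    div_pos (mul_pos (hp j hj) (zpow_pos hτ j)) hPpos
  have h1 : ∑ j ∈ S, p j * τ ^ j / P τ = 1 := by
    rw [← Finset.sum_div, ← hP, div_self hPpos.ne']
  have h0 : ∑ j ∈ S, p j * τ ^ j / P τ * j = 0 := by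
    simp_rw [div_mul_eq_mul_div]
    rw [← Finset.sum_div, hmean, zero_div]
  have hv : ∑ j ∈ S, p j * τ ^ j / P τ * j ^ 2 = τ ^ 2 * deriv (deriv P) τ / P τ := by
    simp_rw [div_mul_eq_mul_div]
    rw [← Finset.sum_div, hsecond]
  have hvar : 0 < ∑ j ∈ S, p j * τ ^ j / P τ * j ^ 2 := by
    refine Finset.sum_pos' (fun j hj => mul_nonneg (hq j hj).le (sq_nonneg _))
      ⟨S.max' hne, S.max'_mem hne, mul_pos (hq _ (S.max'_mem hne)) ?_⟩
    have : (0 : ℝ) < S.max' hne := by exact_mod_cast hmax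
    positivity
  have hgcd : S.gcd (fun j => j - S.min' hne) = 1 := by
    rw [← haper, hc]
    simp only [sub_eq_add_neg]
  refine (tendsto_sqrt_mul_bridge_sum hq h1 h0 (S.min'_mem hne) hgcd hvar).congr fun n => ?_
  have hVn : ∑ s ∈ (Fintype.piFinset fun _ : Fin n => S).filter (fun s => ∑ i, s i = 0),
      ∏ i, p (s i) * τ ^ s i / P τ = V n / P τ ^ n := by
    rw [hV, Finset.sum_div]
    refine Finset.sum_congr rfl fun s hs => ?_
    have hz : ∏ i, τ ^ s i = 1 := by
      rw [prod_zpow_eq_zpow_sum _ _ hτ.ne', (Finset.mem_filter.1 hs).2, zpow_zero]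
    rw [Finset.prod_div_distrib, Finset.prod_mul_distrib, hz, mul_one, Fin.prod_const]
  rw [hVn, hv, Real.sqrt_div' _ hPpos.le, Real.sqrt_mul (sq_nonneg τ), Real.sqrt_sq hτ.le]
  have := Real.sqrt_pos.2 hPpos
  field_simp
end

section
/- (Generating function of paths terminating at altitude m.) Let 0 < ε ≤ ρ and suppose u_1, …, u_c : (0,ε) → ℂ∖{0} are differentiable functions such that for every z ∈ (0,ε) the values u_1(z), …, u_c(z) are pairwise distinct, each satisfies z·P(u_j(z)) = 1, and u_j(z) → 0 as z → 0⁺ (these are the c small branches of the kernel). Then for every integer m < c and every z ∈ (0,ε), the series Σ_{n≥0} W_{m,n} zⁿ converges and equals z · Σ_{j=1}^{c} u_j'(z) / u_j(z)^{m+1}, where W_{m,n} := Σ over tuples (s_1,…,s_n) ∈ Sⁿ with s_1+⋯+s_n = m of ∏_{i=1}^n p_{s_i}. -/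
open Polynomial Metric Complex Classical in
/-- The argument principle for complex polynomials on a disc. -/
theorem circleIntegral_eval_derivative_div_eval (K : ℂ[X]) {a : ℂ} {R : ℝ} (hR : 0 ≤ R)
    (hK : ∀ x ∈ sphere a R, K.eval x ≠ 0) :
    (∮ x in C(a, R), K.derivative.eval x / K.eval x) =
      2 * Real.pi * I * (K.roots.countP (· ∈ ball a R) : ℂ) := by
  have aux : ∀ s : Multiset ℂ, (∀ r ∈ s, r ∉ sphere a R) →
      CircleIntegrable (fun x => (s.map fun r => 1 / (x - r)).sum) a R ∧
      (∮ x in C(a, R), (s.map fun r => 1 / (x - r)).sum) =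
        2 * Real.pi * I * (s.countP (· ∈ ball a R) : ℂ) := by
    intro s
    induction s using Multiset.induction_on with
    | empty => intro _; simp [circleIntegral]
    | cons r s ih =>
      intro hs
      obtain ⟨hint, hval⟩ := ih fun r hr => hs r (Multiset.mem_cons_of_mem hr)
      have hr : r ∉ sphere a R := hs r (Multiset.mem_cons_self r s)
      have hrint : CircleIntegrable (fun x => 1 / (x - r)) a R := by
        simp only [one_div]
        exact circleIntegrable_sub_inv_iff.2 (Or.inr (by rwa [abs_of_nonneg hR]))
      simp only [Multiset.map_cons, Multiset.sum_cons]
      refine ⟨hrint.add hint, ?_⟩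
      rw [circleIntegral.integral_add hrint hint, hval]
      by_cases hrb : r ∈ ball a R
      · rw [Multiset.countP_cons_of_pos _ hrb]
        simp only [one_div, circleIntegral.integral_sub_inv_of_mem_ball hrb]
        push_cast
        ring
      · rw [Multiset.countP_cons_of_neg _ hrb]
        have hrc : ∀ x ∈ closedBall a R, x - r ≠ 0 := by
          rintro x hx h
          rw [sub_eq_zero.1 h, ← ball_union_sphere] at hx
          exact hx.elim hrb hr
        have : DifferentiableOn ℂ (fun x => 1 / (x - r)) (closedBall a R) := by
          intro x hx
          have := hrc x hx
          fun_prop (disch := assumption)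
        have h0 : (∮ x in C(a, R), 1 / (x - r)) = 0 :=
          circleIntegral_eq_zero_of_differentiable_on_off_countable hR Set.countable_empty
            this.continuousOn fun x hx => this.differentiableAt
              (closedBall_mem_nhds_of_mem hx.1)
        rw [h0, zero_add]
  rw [← (aux K.roots ?_).2]
  · exact circleIntegral.integral_congr hR fun x hx =>
      (IsAlgClosed.splits K).eval_derivative_div_eval_of_ne_zero (hK x hx)
  · intro r hr hrs
    exact hK r hrs (isRoot_of_mem_roots hr)

open Polynomial Metric Complex in
/-- The residue theorem for the quotient of a holomorphic function by a polynomial all of whose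
zeros in the disc are simple. -/
theorem circleIntegral_div_eval_of_eq_nodal_mul {ι : Type*} {s : Finset ι} (hs : s.Nonempty)
    {v : ι → ℂ} (hv : Set.InjOn v s) {a : ℂ} {R : ℝ} (hvb : ∀ i ∈ s, v i ∈ ball a R)
    {K L : ℂ[X]} (hKL : K = Lagrange.nodal s v * L) (hL : ∀ x ∈ closedBall a R, L.eval x ≠ 0)
    {f : ℂ → ℂ} (hf : DifferentiableOn ℂ f (closedBall a R)) :
    (∮ x in C(a, R), f x / K.eval x) =
      2 * Real.pi * I * ∑ i ∈ s, f (v i) / K.derivative.eval (v i) := by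
  classical
  have hR : 0 ≤ R := by
    obtain ⟨i, hi⟩ := hs
    exact dist_nonneg.trans (hvb i hi).le
  have hg : DifferentiableOn ℂ (fun x => f x / L.eval x) (closedBall a R) :=
    hf.div L.differentiable.differentiableOn hL
  have hxv : ∀ x ∈ sphere a R, ∀ i ∈ s, x ≠ v i := by
    rintro x hx i hi rfl
    exact (mem_ball.1 (hvb i hi)).ne hx
  have hsplit : Set.EqOn (fun x => f x / K.eval x)
      (fun x => ∑ i ∈ s, Lagrange.nodalWeight s v i * ((x - v i)⁻¹ * (f x / L.eval x)))
      (sphere a R) := by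
    intro x hx
    have h1 := Lagrange.eval_interpolate_not_at_node (s := s) (v := v) 1 (hxv x hx)
    rw [Lagrange.interpolate_one hv hs, eval_one] at h1
    simp only [Pi.one_apply, mul_one] at h1
    have h2 : (∑ i ∈ s, Lagrange.nodalWeight s v i * ((x - v i)⁻¹ * (f x / L.eval x))) =
        (∑ i ∈ s, Lagrange.nodalWeight s v i * (x - v i)⁻¹) * (f x / L.eval x) := by
      rw [Finset.sum_mul]
      exact Finset.sum_congr rfl fun i _ => by ring
    have h3 := eq_inv_of_mul_eq_one_right h1.symm
    dsimp only
    rw [h2, h3, hKL, eval_mul]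
    simp only [div_eq_mul_inv, mul_inv]
    ring
  rw [circleIntegral.integral_congr hR hsplit, circleIntegral.integral_fun_sum, Finset.mul_sum]
  · refine Finset.sum_congr rfl fun i hi => ?_
    have hcauchy : (∮ x in C(a, R), (x - v i)⁻¹ • (f x / L.eval x)) =
        (2 * Real.pi * I : ℂ) • (f (v i) / L.eval (v i)) :=
      circleIntegral_sub_inv_smul_of_differentiable_on_off_countable Set.countable_empty
        (hvb i hi) hg.continuousOn fun x hx => hg.differentiableAt
          (closedBall_mem_nhds_of_mem hx.1)
    simp only [smul_eq_mul] at hcauchy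
    have hK' : K.derivative.eval (v i) =
        (Lagrange.nodal s v).derivative.eval (v i) * L.eval (v i) := by
      rw [hKL, derivative_mul, eval_add, eval_mul, eval_mul, Lagrange.eval_nodal_at_node hi]
      ring
    rw [circleIntegral.integral_const_mul, hcauchy, hK',
      Lagrange.nodalWeight_eq_eval_derivative_nodal hi]
    simp only [div_eq_mul_inv, mul_inv]
    ring
  · intro i hi
    refine ContinuousOn.circleIntegrable hR (continuousOn_const.mul (ContinuousOn.mul ?_
      (hg.continuousOn.mono sphere_subset_closedBall)))
    exact ContinuousOn.inv₀ (by fun_prop) fun x hx => sub_ne_zero.2 (hxv x hx i hi)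

open Metric in
/-- Termwise integration of a geometric series over a circle. -/
theorem hasSum_circleIntegral_pow_mul {a : ℂ} {R : ℝ} (hR : 0 ≤ R) {q g : ℂ → ℂ} {r : ℝ}
    (hr : r < 1) (hqr : ∀ x ∈ sphere a R, ‖q x‖ ≤ r) (hq : ContinuousOn q (sphere a R))
    (hg : ContinuousOn g (sphere a R)) :
    HasSum (fun n : ℕ => ∮ x in C(a, R), q x ^ n * g x) (∮ x in C(a, R), (1 - q x)⁻¹ * g x) := by
  have hmem : ∀ θ : ℝ, circleMap a R θ ∈ sphere a R := circleMap_mem_sphere a hR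
  have hr0 : 0 ≤ r := (norm_nonneg _).trans (hqr _ (hmem 0))
  have hqc : Continuous fun θ => q (circleMap a R θ) :=
    hq.comp_continuous (continuous_circleMap a R) hmem
  have hgc : Continuous fun θ => g (circleMap a R θ) :=
    hg.comp_continuous (continuous_circleMap a R) hmem
  simp only [circleIntegral, deriv_circleMap, smul_eq_mul]
  refine intervalIntegral.hasSum_integral_of_dominated_convergence
    (fun n θ => r ^ n * (R * ‖g (circleMap a R θ)‖)) (fun n => ?_) (fun n => ?_) ?_ ?_ ?_
  · exact (((continuous_circleMap 0 R).mul continuous_const).mul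
      ((hqc.pow n).mul hgc)).aestronglyMeasurable
  · refine Filter.Eventually.of_forall fun θ _ => ?_
    have h1 := pow_le_pow_left₀ (norm_nonneg _) (hqr _ (hmem θ)) n
    have : ‖circleMap 0 R θ * Complex.I * (q (circleMap a R θ) ^ n * g (circleMap a R θ))‖ =
        ‖q (circleMap a R θ)‖ ^ n * (R * ‖g (circleMap a R θ)‖) := by
      simp [abs_of_nonneg hR]
      ring
    rw [this]
    gcongr
  · exact Filter.Eventually.of_forall fun θ _ =>
      (summable_geometric_of_lt_one hr0 hr).mul_right _
  · simp only [tsum_mul_right]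
    exact (continuous_const.mul (continuous_const.mul hgc.norm)).intervalIntegrable _ _
  · refine Filter.Eventually.of_forall fun θ _ => ?_
    exact ((hasSum_geometric_of_norm_lt_one ((hqr _ (hmem θ)).trans_lt hr)).mul_right _).mul_left _

open Metric in
/-- The logarithmic derivative of `1 - q` has no period along a circle where `‖q‖ < 1`. -/
theorem circleIntegral_div_one_sub_eq_zero {a : ℂ} {R : ℝ} (hR : 0 ≤ R) {q q' : ℂ → ℂ}
    (hq : ∀ x ∈ sphere a R, HasDerivAt q (q' x) x) (hq1 : ∀ x ∈ sphere a R, ‖q x‖ < 1) :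
    (∮ x in C(a, R), -q' x / (1 - q x)) = 0 := by
  refine circleIntegral.integral_eq_zero_of_hasDerivWithinAt
    (f := fun x => Complex.log (1 - q x)) hR fun x hx => ?_
  refine (HasDerivAt.clog ((hq x hx).const_sub 1) (Or.inl ?_)).hasDerivWithinAt
  have := (Complex.re_le_norm (q x)).trans_lt (hq1 x hx)
  simpa using this

/-- The `n`-th power of the weight polynomial, expanded over walks of length `n`. -/
theorem sum_mul_zpow_pow (S : Finset ℤ) (p : ℤ → ℂ) {x : ℂ} (hx : x ≠ 0) (n : ℕ) :
    (∑ j ∈ S, p j * x ^ j) ^ n =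
      ∑ s ∈ Fintype.piFinset fun _ : Fin n => S, (∏ i, p (s i)) * x ^ (∑ i, s i) := by
  have hz : ∀ (s : Fin n → ℤ), x ^ (∑ i, s i) = ∏ i, x ^ s i := fun s => by
    induction (Finset.univ : Finset (Fin n)) using Finset.cons_induction with
    | empty => simp
    | cons i t hi ih => rw [Finset.sum_cons, Finset.prod_cons, zpow_add₀ hx, ih]
  rw [Finset.sum_pow']
  exact Finset.sum_congr rfl fun s _ => by rw [hz, Finset.prod_mul_distrib]

/-- Extraction of the coefficient counting walks of length `n` ending at altitude `m`. -/
theorem circleIntegral_sum_mul_zpow_pow_mul_zpow (S : Finset ℤ) (p : ℤ → ℂ) {R : ℝ} (hR : 0 < R)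
    (m : ℤ) (n : ℕ) :
    (∮ x in C(0, R), (∑ j ∈ S, p j * x ^ j) ^ n * x ^ (-m - 1)) =
      2 * Real.pi * Complex.I *
        ∑ s ∈ (Fintype.piFinset fun _ : Fin n => S).filter (fun s => ∑ i, s i = m),
          ∏ i, p (s i) := by
  have hx0 : ∀ x ∈ Metric.sphere (0 : ℂ) R, x ≠ 0 := by
    rintro x hx rfl
    simp [hR.ne] at hx
  have hexp : Set.EqOn (fun x : ℂ => (∑ j ∈ S, p j * x ^ j) ^ n * x ^ (-m - 1))
      (fun x => ∑ s ∈ Fintype.piFinset fun _ : Fin n => S,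
        (∏ i, p (s i)) * (x - 0) ^ (∑ i, s i - m - 1)) (Metric.sphere 0 R) := by
    intro x hx
    have hx := hx0 x hx
    simp only [sum_mul_zpow_pow S p hx, Finset.sum_mul, sub_zero]
    refine Finset.sum_congr rfl fun s _ => ?_
    rw [mul_assoc, ← zpow_add₀ hx]
    congr 2
    ring
  rw [circleIntegral.integral_congr hR.le hexp, circleIntegral.integral_fun_sum,
    Finset.sum_filter, Finset.mul_sum]
  · refine Finset.sum_congr rfl fun s _ => ?_
    rw [circleIntegral.integral_const_mul]
    split_ifs with h
    · have : ∑ i, s i - m - 1 = -1 := by rw [h]; ring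
      simp only [this, zpow_neg_one]
      rw [circleIntegral.integral_sub_center_inv 0 hR.ne', mul_comm]
    · rw [circleIntegral.integral_sub_zpow_of_ne (by omega)]
      simp
  · intro s _
    refine ContinuousOn.circleIntegrable hR.le (continuousOn_const.mul ?_)
    exact ContinuousOn.zpow₀ (by fun_prop) _ fun x hx => Or.inl (by simpa using hx0 x hx)

/-- The derivative of a Laurent polynomial with exponents in `S`. -/
theorem hasDerivAt_sum_mul_zpow (S : Finset ℤ) (p : ℤ → ℂ) {x : ℂ} (hx : x ≠ 0) :
    HasDerivAt (fun x : ℂ => ∑ j ∈ S, p j * x ^ j) (∑ j ∈ S, p j * (j * x ^ (j - 1))) x :=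
  HasDerivAt.fun_sum fun j _ => (hasDerivAt_zpow j x (Or.inl hx)).const_mul _

open Polynomial in
/-- The kernel `x ^ c * (1 - z * P x)` as a polynomial in `x`. -/
noncomputable def kernelPolynomial (S : Finset ℤ) (p : ℤ → ℂ) (c : ℕ) (z : ℂ) : ℂ[X] :=
  X ^ c - C z * ∑ j ∈ S, C (p j) * X ^ (j + c).toNat

namespace kernelPolynomial

open Polynomial Metric

variable {S : Finset ℤ} {p : ℤ → ℂ} {c : ℕ} {z : ℂ}

theorem eval_eq (hS : ∀ j ∈ S, -(c : ℤ) ≤ j) {x : ℂ} (hx : x ≠ 0) :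
    (kernelPolynomial S p c z).eval x = x ^ c * (1 - z * ∑ j ∈ S, p j * x ^ j) := by
  have h : ∀ j ∈ S, p j * x ^ (j + c).toNat = x ^ c * (p j * x ^ j) := by
    intro j hj
    have h1 := hS j hj
    rw [← zpow_natCast x (j + c).toNat, Int.toNat_of_nonneg (by omega), zpow_add₀ hx,
      zpow_natCast]
    ring
  simp only [kernelPolynomial, eval_sub, eval_pow, eval_X, eval_mul, eval_C, eval_finsetSum]
  rw [Finset.sum_congr rfl h, ← Finset.mul_sum]
  ring

theorem eval_zero_ne_zero (hS : ∀ j ∈ S, -(c : ℤ) ≤ j) (hc : 0 < c) (hcS : -(c : ℤ) ∈ S)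
    (hp : p (-c) ≠ 0) (hz : z ≠ 0) : (kernelPolynomial S p c z).eval 0 ≠ 0 := by
  simp only [kernelPolynomial, eval_sub, eval_pow, eval_X, eval_mul, eval_C, eval_finsetSum]
  rw [Finset.sum_eq_single_of_mem _ hcS, zero_pow hc.ne']
  · simp [hz, hp]
  · intro j hj hjc
    have := hS j hj
    rw [zero_pow (by omega), mul_zero]

theorem eval_derivative_eq (hS : ∀ j ∈ S, -(c : ℤ) ≤ j) {x : ℂ} (hx : x ≠ 0) :
    (kernelPolynomial S p c z).derivative.eval x =
      c * x ^ (c - 1) * (1 - z * ∑ j ∈ S, p j * x ^ j) -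
        x ^ c * (z * ∑ j ∈ S, p j * (j * x ^ (j - 1))) := by
  have h1 := (hasDerivAt_pow c x).mul
    (((hasDerivAt_sum_mul_zpow S p hx).const_mul z).const_sub 1)
  have h2 : (fun y => (kernelPolynomial S p c z).eval y) =ᶠ[nhds x]
      (fun y => y ^ c) * fun y => 1 - z * ∑ j ∈ S, p j * y ^ j := by
    filter_upwards [isOpen_ne.mem_nhds hx] with y hy using eval_eq hS hy
  rw [((kernelPolynomial S p c z).hasDerivAt x).unique (h1.congr_of_eventuallyEq h2)]
  ring

open Classical in
theorem countP_roots_ball (hS : ∀ j ∈ S, -(c : ℤ) ≤ j) {R : ℝ} (hR : 0 < R)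
    (hzR : ∀ x ∈ sphere (0 : ℂ) R, ‖z * ∑ j ∈ S, p j * x ^ j‖ < 1) :
    (kernelPolynomial S p c z).roots.countP (· ∈ ball (0 : ℂ) R) = c := by
  have hx0 : ∀ x ∈ sphere (0 : ℂ) R, x ≠ 0 := fun x hx => ne_of_mem_sphere hx hR.ne'
  have h1 : ∀ x ∈ sphere (0 : ℂ) R, 1 - z * ∑ j ∈ S, p j * x ^ j ≠ 0 := by
    intro x hx h
    have := hzR x hx
    rw [← sub_eq_zero.1 h] at this
    simp at this
  have hK : ∀ x ∈ sphere (0 : ℂ) R, (kernelPolynomial S p c z).eval x ≠ 0 := fun x hx => by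
    rw [eval_eq hS (hx0 x hx)]
    exact mul_ne_zero (pow_ne_zero _ (hx0 x hx)) (h1 x hx)
  have harg := circleIntegral_eval_derivative_div_eval _ hR.le hK
  have hsplit : Set.EqOn
      (fun x => (kernelPolynomial S p c z).derivative.eval x / (kernelPolynomial S p c z).eval x)
      (fun x => (c : ℂ) * (x - 0)⁻¹ + -(z * ∑ j ∈ S, p j * (j * x ^ (j - 1))) /
        (1 - z * ∑ j ∈ S, p j * x ^ j)) (sphere 0 R) := by
    intro x hx
    have hx0 := hx0 x hx
    have h1 := h1 x hx
    have hc : (c : ℂ) * x ^ (c - 1) = c * x ^ c * x⁻¹ := by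
      rcases Nat.eq_zero_or_pos c with rfl | hc
      · simp
      · rw [← Nat.sub_add_cancel hc, Nat.add_sub_cancel, pow_succ]
        field_simp
    simp only [eval_eq hS hx0, eval_derivative_eq hS hx0, hc, sub_zero]
    field_simp
    ring
  have hderiv : ∀ x ∈ sphere (0 : ℂ) R, HasDerivAt (fun x => z * ∑ j ∈ S, p j * x ^ j)
      (z * ∑ j ∈ S, p j * (j * x ^ (j - 1))) x :=
    fun x hx => (hasDerivAt_sum_mul_zpow S p (hx0 x hx)).const_mul z
  rw [circleIntegral.integral_congr hR.le hsplit, circleIntegral.integral_add,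
    circleIntegral_div_one_sub_eq_zero hR.le hderiv hzR, circleIntegral.integral_const_mul,
    circleIntegral.integral_sub_center_inv 0 hR.ne', add_zero, mul_comm] at harg
  · exact_mod_cast (mul_left_cancel₀ Complex.two_pi_I_ne_zero harg).symm
  · refine ContinuousOn.circleIntegrable hR.le (continuousOn_const.mul ?_)
    exact ContinuousOn.inv₀ (by fun_prop) fun x hx => by simpa using hx0 x hx
  · refine ContinuousOn.circleIntegrable hR.le (ContinuousOn.div (ContinuousOn.neg
      (continuousOn_const.mul (continuousOn_finsetSum _ fun j _ => continuousOn_const.mul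
      (continuousOn_const.mul (continuousOn_id.zpow₀ _ fun x hx => Or.inl (hx0 x hx))))))
      (fun x hx => ((hderiv x hx).const_sub 1).continuousAt.continuousWithinAt) h1)

theorem exists_eq_nodal_mul (hS : ∀ j ∈ S, -(c : ℤ) ≤ j) (hc : 0 < c) (hcS : -(c : ℤ) ∈ S)
    (hp : p (-c) ≠ 0) (hz : z ≠ 0) {R : ℝ} (hR : 0 < R)
    (hzR : ∀ x ∈ sphere (0 : ℂ) R, ‖z * ∑ j ∈ S, p j * x ^ j‖ < 1)
    {v : Fin c → ℂ} (hv : Function.Injective v) (hvb : ∀ i, v i ∈ ball (0 : ℂ) R)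
    (hv0 : ∀ i, v i ≠ 0) (hvz : ∀ i, z * ∑ j ∈ S, p j * v i ^ j = 1) :
    ∃ L : ℂ[X], kernelPolynomial S p c z = Lagrange.nodal Finset.univ v * L ∧
      ∀ x ∈ closedBall (0 : ℂ) R, L.eval x ≠ 0 := by
  classical
  have hK0 : kernelPolynomial S p c z ≠ 0 := by
    intro h
    apply eval_zero_ne_zero hS hc hcS hp hz
    rw [h, eval_zero]
  have hdvd : Lagrange.nodal Finset.univ v ∣ kernelPolynomial S p c z := by
    refine Finset.prod_dvd_of_coprime ?_ fun i _ => ?_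
    · exact fun i _ j _ hij => pairwise_coprime_X_sub_C hv hij
    · rw [dvd_iff_isRoot, IsRoot, eval_eq hS (hv0 i), hvz i, sub_self, mul_zero]
  obtain ⟨L, hL⟩ := hdvd
  have hcount := countP_roots_ball hS hR hzR
  have hnodal : (Lagrange.nodal Finset.univ v).roots = Finset.univ.val.map v := by
    have : Lagrange.nodal Finset.univ v =
        ((Finset.univ.val.map v).map fun a => X - C a).prod := by
      rw [Multiset.map_map]
      rfl
    rw [this, roots_multiset_prod_X_sub_C]
  have hall : (Finset.univ.val.map v).countP (· ∈ ball (0 : ℂ) R) = c := by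
    rw [Multiset.countP_eq_card.2]
    · simp
    · simpa using hvb
  rw [hL, roots_mul (hL ▸ hK0), Multiset.countP_add, hnodal, hall] at hcount
  refine ⟨L, hL, fun x hx hLx => ?_⟩
  rw [← ball_union_sphere] at hx
  rcases hx with hx | hx
  · have hL0 : L ≠ 0 := right_ne_zero_of_mul (hL ▸ hK0)
    have : 0 < L.roots.countP (· ∈ ball (0 : ℂ) R) :=
      Multiset.countP_pos.2 ⟨x, (mem_roots hL0).2 hLx, hx⟩
    omega
  · have h0 : (kernelPolynomial S p c z).eval x = 0 := by rw [hL, eval_mul, hLx, mul_zero]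
    have hx0 : x ≠ 0 := ne_of_mem_sphere hx hR.ne'
    rw [eval_eq hS hx0, mul_eq_zero, sub_eq_zero] at h0
    have := hzR x hx
    rw [← h0.resolve_left (pow_ne_zero _ hx0)] at this
    simp at this

end kernelPolynomial

open Metric in
/-- The generating function of walks ending at altitude `m < c`, evaluated at a point `z` such that
the kernel `1 - z * P x` does not vanish on a circle, in terms of the `c` zeros of the kernel inside
that circle. -/
theorem hasSum_walks_of_kernel_zeros {S : Finset ℤ} {p : ℤ → ℂ} {c : ℕ} {z : ℂ}
    (hS : ∀ j ∈ S, -(c : ℤ) ≤ j) (hc : 0 < c) (hcS : -(c : ℤ) ∈ S)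
    (hp : p (-c) ≠ 0) (hz : z ≠ 0) {R r : ℝ} (hR : 0 < R) (hr : r < 1)
    (hzR : ∀ x ∈ sphere (0 : ℂ) R, ‖z * ∑ j ∈ S, p j * x ^ j‖ ≤ r)
    {v : Fin c → ℂ} (hv : Function.Injective v) (hvb : ∀ i, v i ∈ ball (0 : ℂ) R)
    (hv0 : ∀ i, v i ≠ 0) (hvz : ∀ i, z * ∑ j ∈ S, p j * v i ^ j = 1) {m : ℤ} (hm : m < c) :
    HasSum (fun n : ℕ =>
      (∑ s ∈ (Fintype.piFinset fun _ : Fin n => S).filter (fun s => ∑ i, s i = m),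
        ∏ i, p (s i)) * z ^ n)
      (∑ i, v i ^ (-m - 1) / -(z * ∑ j ∈ S, p j * (j * v i ^ (j - 1)))) := by
  have hzR1 : ∀ x ∈ sphere (0 : ℂ) R, ‖z * ∑ j ∈ S, p j * x ^ j‖ < 1 :=
    fun x hx => (hzR x hx).trans_lt hr
  obtain ⟨L, hKL, hL⟩ := kernelPolynomial.exists_eq_nodal_mul hS hc hcS hp hz hR hzR1 hv hvb hv0 hvz
  have hx0 : ∀ x ∈ sphere (0 : ℂ) R, x ≠ 0 := fun x hx => ne_of_mem_sphere hx hR.ne'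
  have hcne : (Finset.univ : Finset (Fin c)).Nonempty := ⟨⟨0, hc⟩, Finset.mem_univ _⟩
  obtain ⟨k, hk⟩ : ∃ k : ℕ, (k : ℤ) = c + (-m - 1) := ⟨(c + (-m - 1)).toNat, by omega⟩
  have hpow : ∀ x : ℂ, x ≠ 0 → x ^ k = x ^ c * x ^ (-m - 1) := fun x hx => by
    rw [← zpow_natCast, hk, zpow_add₀ hx, zpow_natCast]
  have hres := circleIntegral_div_eval_of_eq_nodal_mul hcne hv.injOn (fun i _ => hvb i) hKL hL
    (f := fun x => x ^ k) (by fun_prop)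
  have hgeom := hasSum_circleIntegral_pow_mul hR.le hr hzR
    (fun x hx => ((hasDerivAt_sum_mul_zpow S p
      (hx0 x hx)).const_mul z).continuousAt.continuousWithinAt)
    (continuousOn_id.zpow₀ (-m - 1) fun x hx => Or.inl (hx0 x hx))
  have hint : (∮ x in C(0, R), (1 - z * ∑ j ∈ S, p j * x ^ j)⁻¹ * id x ^ (-m - 1)) =
      ∮ x in C(0, R), x ^ k / (kernelPolynomial S p c z).eval x := by
    refine circleIntegral.integral_congr hR.le fun x hx => ?_
    have hxc := pow_ne_zero c (hx0 x hx)
    simp only [id, kernelPolynomial.eval_eq hS (hx0 x hx), hpow x (hx0 x hx)]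
    rw [mul_div_mul_left _ _ hxc, div_eq_inv_mul]
  rw [hint, hres] at hgeom
  have h2 := hgeom.mul_left (2 * Real.pi * Complex.I)⁻¹
  rw [inv_mul_cancel_left₀ Complex.two_pi_I_ne_zero] at h2
  convert! h2 using 1
  · funext n
    simp only [id, mul_pow, mul_assoc, circleIntegral.integral_const_mul]
    have := circleIntegral_sum_mul_zpow_pow_mul_zpow S p hR m n
    rw [this]
    field_simp
  · refine Finset.sum_congr rfl fun i _ => ?_
    rw [kernelPolynomial.eval_derivative_eq hS (hv0 i), hvz i, hpow _ (hv0 i), sub_self, mul_zero,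
      zero_sub, neg_mul_eq_mul_neg (v i ^ c), mul_div_mul_left _ _ (pow_ne_zero _ (hv0 i))]

/-- A continuous function on an interval `(0, ε)` that tends to `0` at `0` and whose norm avoids the
value `τ > 0` stays in the ball of radius `τ`. -/
theorem norm_lt_of_tendsto_zero_of_norm_ne {E : Type*} [NormedAddCommGroup E] {ε τ : ℝ} (hτ : 0 < τ)
    {u : ℝ → E} (hu : ContinuousOn u (Set.Ioo 0 ε))
    (h0 : Filter.Tendsto u (nhdsWithin 0 (Set.Ioi 0)) (nhds 0))
    (hne : ∀ z ∈ Set.Ioo 0 ε, ‖u z‖ ≠ τ) : ∀ z ∈ Set.Ioo 0 ε, ‖u z‖ < τ := by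
  intro z hz
  by_contra! hlt
  have hsmall : ∀ᶠ w in nhdsWithin (0 : ℝ) (Set.Ioi 0), ‖u w‖ < τ := by
    filter_upwards [h0.eventually (Metric.ball_mem_nhds 0 hτ)] with w hw
    simpa using hw
  obtain ⟨w, hw, hwmem⟩ :=
    (hsmall.and (Ioo_mem_nhdsGT (hz.1.trans hz.2))).exists
  obtain ⟨y, hy, hyτ⟩ := isPreconnected_Ioo.intermediate_value hwmem hz hu.norm ⟨hw.le, hlt⟩
  exact hne y hy hyτ

/-- Implicit differentiation of `z * P (u z) = 1`. -/
theorem mul_deriv_eq_of_kernel {S : Finset ℤ} {p : ℤ → ℂ} {u : ℝ → ℂ} {z : ℝ} (hz : z ≠ 0)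
    (hu0 : u z ≠ 0) (hu : DifferentiableAt ℝ u z)
    (hker : ∀ᶠ w : ℝ in nhds z, (w : ℂ) * ∑ j ∈ S, p j * u w ^ j = 1) :
    (z : ℂ) * deriv u z = 1 / -(z * ∑ j ∈ S, p j * (j * u z ^ (j - 1))) := by
  have h1 : HasDerivAt (fun w : ℝ => (w : ℂ)) 1 z := Complex.ofRealCLM.hasDerivAt
  have h2 : HasDerivAt (fun w : ℝ => ∑ j ∈ S, p j * u w ^ j) _ z :=
    (hasDerivAt_sum_mul_zpow S p hu0).comp z hu.hasDerivAt
  have h3 := (h1.fun_mul h2).unique ((hasDerivAt_const z (1 : ℂ)).congr_of_eventuallyEq hker)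
  have h4 := hker.self_of_nhds
  have hzc : (z : ℂ) ≠ 0 := by exact_mod_cast hz
  set Q := ∑ j ∈ S, p j * (j * u z ^ (j - 1))
  have h5 : (z : ℂ) * deriv u z * -(z * Q) = 1 := by
    linear_combination h4 - (z : ℂ) * h3
  exact eq_one_div_of_mul_eq_one_left h5

/-- Banderier–Flajolet: the generating function of walks terminating at altitude
`m < c` is `W_m(z) = z · ∑_{j=1}^c u_j'(z) / u_j(z)^{m+1}`, where `u_1, …, u_c`
are the small branches of the kernel. -/
theorem stmt6
    (S : Finset ℤ) (hne : S.Nonempty)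
    (hmin : S.min' hne < 0) (hmax : 0 < S.max' hne)
    (p : ℤ → ℝ) (hp : ∀ j ∈ S, 0 < p j)
    (c : ℕ) (hcpos : 0 < c) (hc : (c : ℤ) = -S.min' hne)
    (Pr : ℝ → ℝ) (hPr : ∀ u : ℝ, Pr u = ∑ j ∈ S, p j * u ^ j)
    (Pc : ℂ → ℂ) (hPc : ∀ u : ℂ, Pc u = ∑ j ∈ S, (p j : ℂ) * u ^ j)
    (τ : ℝ) (hτ : 0 < τ) (hτ' : deriv Pr τ = 0)
    (ρ : ℝ) (hρ : ρ = 1 / Pr τ)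
    (ε : ℝ) (hε : 0 < ε) (hερ : ε ≤ ρ)
    (u : Fin c → ℝ → ℂ)
    (hne0 : ∀ j, ∀ z ∈ Set.Ioo (0:ℝ) ε, u j z ≠ 0)
    (hdiff : ∀ j, ∀ z ∈ Set.Ioo (0:ℝ) ε, DifferentiableAt ℝ (u j) z)
    (hdist : ∀ z ∈ Set.Ioo (0:ℝ) ε, ∀ j k : Fin c, j ≠ k → u j z ≠ u k z)
    (hker : ∀ j, ∀ z ∈ Set.Ioo (0:ℝ) ε, (z : ℂ) * Pc (u j z) = 1)
    (hsmall : ∀ j, Filter.Tendsto (u j) (nhdsWithin 0 (Set.Ioi 0)) (nhds 0))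
    (W : ℤ → ℕ → ℝ)
    (hW : ∀ (m : ℤ) (n : ℕ), W m n =
      ∑ s ∈ (Fintype.piFinset fun _ : Fin n => S).filter (fun s => ∑ i, s i = m),
        ∏ i, p (s i)) :
    ∀ m : ℤ, m < (c : ℤ) → ∀ z ∈ Set.Ioo (0:ℝ) ε,
      HasSum (fun n : ℕ => (W m n : ℂ) * (z : ℂ) ^ n)
        ((z : ℂ) * ∑ j : Fin c, deriv (u j) z / (u j z) ^ (m + 1)) := by
  intro m hm z hz
  have hS : ∀ j ∈ S, -(c : ℤ) ≤ j := fun j hj => by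
    have := S.min'_le j hj
    omega
  have hcS : -(c : ℤ) ∈ S := by
    rw [hc, neg_neg]
    exact S.min'_mem hne
  have hPτ : 0 < Pr τ := by
    rw [hPr]
    exact Finset.sum_pos (fun j hj => mul_pos (hp j hj) (zpow_pos hτ j)) hne
  have hbound : ∀ w ∈ Set.Ioo 0 ε, w * Pr τ < 1 := fun w hw => by
    have := hw.2.trans_le hερ
    rwa [hρ, lt_div_iff₀ hPτ] at this
  have hnorm : ∀ w ∈ Set.Ioo 0 ε, ∀ x ∈ Metric.sphere (0 : ℂ) τ,
      ‖(w : ℂ) * ∑ j ∈ S, (p j : ℂ) * x ^ j‖ ≤ w * Pr τ := by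
    intro w hw x hx
    rw [norm_mul, Complex.norm_of_nonneg hw.1.le, hPr]
    refine mul_le_mul_of_nonneg_left (norm_sum_le_of_le _ fun j hj => ?_) hw.1.le
    rw [norm_mul, norm_zpow, mem_sphere_zero_iff_norm.1 hx, Complex.norm_of_nonneg (hp j hj).le]
  simp only [hPc] at hker
  have hball : ∀ j, ∀ w ∈ Set.Ioo 0 ε, ‖u j w‖ < τ := fun j => by
    refine norm_lt_of_tendsto_zero_of_norm_ne hτ
      (fun w hw => (hdiff j w hw).continuousAt.continuousWithinAt) (hsmall j) fun w hw hwτ => ?_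
    have := (hnorm w hw (u j w) (mem_sphere_zero_iff_norm.2 hwτ)).trans_lt (hbound w hw)
    rw [hker j w hw] at this
    simp at this
  have hmain := hasSum_walks_of_kernel_zeros (p := fun j => (p j : ℂ)) (z := z) hS hcpos hcS
    (by exact_mod_cast (hp _ hcS).ne') (by exact_mod_cast hz.1.ne') hτ (hbound z hz) (hnorm z hz)
    (v := fun j => u j z) (fun j k hjk => by_contra fun h => hdist z hz j k h hjk)
    (fun j => mem_ball_zero_iff.2 (hball j z hz)) (fun j => hne0 j z hz)
    (fun j => hker j z hz) hm
  convert! hmain using 1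
  · funext n
    rw [hW]
    push_cast
    rfl
  · rw [Finset.mul_sum]
    refine Finset.sum_congr rfl fun j _ => ?_
    have hder := mul_deriv_eq_of_kernel hz.1.ne' (hne0 j z hz) (hdiff j z hz)
      (by filter_upwards [isOpen_Ioo.mem_nhds hz] with w hw using hker j w hw)
    rw [← mul_div_assoc, hder, div_eq_mul_inv, ← zpow_neg, neg_add']
    ring
end

section
/- (Square-root singular behaviour of the dominant branches at z = ρ.) For z ∈ (0,ρ), let u_1(z) ∈ (0,τ) and v_1(z) ∈ (τ,∞) be the two positive real solutions of z·P(u) = 1, and let σ := √(P''(τ)). Then, as z → ρ⁻, (τ − u_1(z))/√(1 − z/ρ) → √2/(σ·√ρ) and (v_1(z) − τ)/√(1 − z/ρ) → √2/(σ·√ρ). -/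
open Filter

/-- Second-order Taylor quotient at a critical point. -/
lemma tendsto_sub_div_sq_of_critical {f f' : ℝ → ℝ} {a c : ℝ}
    (hf : ∀ᶠ x in nhds a, HasDerivAt f (f' x) x) (hcrit : f' a = 0) (hf' : HasDerivAt f' c a) :
    Tendsto (fun x => (f x - f a) / (x - a) ^ 2) (nhdsWithin a {a}ᶜ) (nhds (c / 2)) := by
  have hne : ∀ᶠ x in nhdsWithin a {a}ᶜ, x ≠ a := self_mem_nhdsWithin
  refine HasDerivAt.lhopital_zero_nhdsNE (f' := f') (g' := fun x => 2 * (x - a))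
    ?_ ?_ ?_ ?_ ?_ ?_
  · filter_upwards [hf.filter_mono nhdsWithin_le_nhds] with x hx using hx.sub_const _
  · refine Eventually.of_forall fun x => ?_
    simpa using ((hasDerivAt_id x).sub_const a).fun_pow 2
  · filter_upwards [hne] with x hx
    exact mul_ne_zero two_ne_zero (sub_ne_zero.mpr hx)
  · have h : Tendsto (fun x => f x - f a) (nhds a) (nhds (f a - f a)) :=
      hf.self_of_nhds.continuousAt.tendsto.sub_const (f a)
    rw [sub_self] at h
    exact h.mono_left nhdsWithin_le_nhds
  · have h : ContinuousAt (fun x : ℝ => (x - a) ^ 2) a := by fun_prop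
    have h' := h.tendsto
    simp only [sub_self, ne_eq, OfNat.ofNat_ne_zero, not_false_eq_true, zero_pow] at h'
    exact h'.mono_left nhdsWithin_le_nhds
  · have h := (hasDerivAt_iff_tendsto_slope.mp hf').div_const 2
    refine h.congr' ?_
    filter_upwards [hne] with x hx
    have : x - a ≠ 0 := sub_ne_zero.mpr hx
    rw [slope_def_field, hcrit]
    field_simp
    ring

/-- Square-root behaviour of an inverse branch of `z * f w = 1` at a nondegenerate critical
point of `f`. -/
lemma tendsto_abs_sub_div_sqrt_of_critical {f f' w : ℝ → ℝ} {a c : ℝ} {l : Filter ℝ}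
    (hf : ∀ᶠ x in nhds a, HasDerivAt f (f' x) x) (hcrit : f' a = 0) (hf' : HasDerivAt f' c a)
    (hc : 0 < c) (ha : 0 < f a)
    (hw : Tendsto w l (nhdsWithin a {a}ᶜ)) (hz : ∀ᶠ z in l, z * f (w z) = 1) :
    Tendsto (fun z => |w z - a| / Real.sqrt (1 - z / (1 / f a))) l
      (nhds (Real.sqrt 2 / (Real.sqrt c * Real.sqrt (1 / f a)))) := by
  have hlim := (tendsto_sub_div_sq_of_critical hf hcrit hf').comp hw
  have hfw : Tendsto (fun z => f (w z)) l (nhds (f a)) :=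
    hf.self_of_nhds.continuousAt.tendsto.comp (hw.mono_right nhdsWithin_le_nhds)
  have hq := (hfw.div hlim (by positivity)).sqrt
  have hval : Real.sqrt (f a / (c / 2))
      = Real.sqrt 2 / (Real.sqrt c * Real.sqrt (1 / f a)) := by
    rw [← Real.sqrt_mul hc.le, ← Real.sqrt_div (by norm_num)]
    congr 1
    field_simp
  rw [hval] at hq
  refine hq.congr' ?_
  filter_upwards [hz, hfw.eventually (lt_mem_nhds ha)] with z h1 h2
  have hzeq : z = 1 / f (w z) := by field_simp; exact h1
  have h3 : 1 - z / (1 / f a) = (f (w z) - f a) / f (w z) := by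
    rw [eq_div_iff h2.ne', div_div_eq_mul_div, div_one]
    linear_combination (-f a) * h1
  rw [h3, ← Real.sqrt_sq_eq_abs, ← Real.sqrt_div (sq_nonneg _)]
  simp only [Function.comp, Pi.div_apply]
  congr 1
  rw [div_div_eq_mul_div, div_div_eq_mul_div, mul_comm]

theorem stmt19
    (S : Finset ℤ) (hne : S.Nonempty)
    (hmin : S.min' hne < 0) (hmax : 0 < S.max' hne)
    (p : ℤ → ℝ) (hp : ∀ j ∈ S, 0 < p j)
    (P : ℝ → ℝ) (hP : ∀ u : ℝ, P u = ∑ j ∈ S, p j * u ^ j)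
    (τ : ℝ) (hτ : 0 < τ) (hτ' : deriv P τ = 0)
    (ρ : ℝ) (hρ : ρ = 1 / P τ)
    (σ : ℝ) (hσ : σ = Real.sqrt (deriv (deriv P) τ))
    (u₁ v₁ : ℝ → ℝ)
    (hu₁ : ∀ z ∈ Set.Ioo (0:ℝ) ρ, u₁ z ∈ Set.Ioo 0 τ ∧ z * P (u₁ z) = 1)
    (hv₁ : ∀ z ∈ Set.Ioo (0:ℝ) ρ, v₁ z ∈ Set.Ioi τ ∧ z * P (v₁ z) = 1) :
    Tendsto (fun z => (τ - u₁ z) / Real.sqrt (1 - z / ρ))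
        (nhdsWithin ρ (Set.Ioo 0 ρ))
        (nhds (Real.sqrt 2 / (σ * Real.sqrt ρ))) ∧
    Tendsto (fun z => (v₁ z - τ) / Real.sqrt (1 - z / ρ))
        (nhdsWithin ρ (Set.Ioo 0 ρ))
        (nhds (Real.sqrt 2 / (σ * Real.sqrt ρ))) := by
  have hPfun : P = fun u => ∑ j ∈ S, p j * u ^ j := funext hP
  have hd1 : ∀ u : ℝ, 0 < u → HasDerivAt P (∑ j ∈ S, p j * (j * u ^ (j - 1))) u := by
    intro u hu
    rw [hPfun]
    exact HasDerivAt.fun_sum fun j _ => (hasDerivAt_zpow j u (Or.inl hu.ne')).const_mul _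
  have hd2 : ∀ u : ℝ, 0 < u →
      HasDerivAt (deriv P) (∑ j ∈ S, p j * (j * (((j - 1 : ℤ) : ℝ) * u ^ (j - 1 - 1)))) u := by
    intro u hu
    have h : HasDerivAt (fun u : ℝ => ∑ j ∈ S, p j * (j * u ^ (j - 1)))
        (∑ j ∈ S, p j * (j * (((j - 1 : ℤ) : ℝ) * u ^ (j - 1 - 1)))) u :=
      HasDerivAt.fun_sum fun j _ =>
        ((hasDerivAt_zpow (j - 1) u (Or.inl hu.ne')).const_mul _).const_mul _
    refine h.congr_of_eventuallyEq ?_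
    filter_upwards [lt_mem_nhds hu] with x hx using (hd1 x hx).deriv
  have hpos2 : ∀ u : ℝ, 0 < u → 0 < deriv (deriv P) u := by
    intro u hu
    rw [(hd2 u hu).deriv]
    refine Finset.sum_pos' (fun j hj => ?_) ⟨S.min' hne, S.min'_mem hne, ?_⟩
    · have h : (0 : ℤ) ≤ j * (j - 1) := by
        rcases le_or_gt j 0 with h | h <;> nlinarith
      have h' : (0 : ℝ) ≤ (j : ℝ) * ((j - 1 : ℤ) : ℝ) := by exact_mod_cast h
      rw [← mul_assoc (j : ℝ)]
      exact mul_nonneg (hp j hj).le (mul_nonneg h' (zpow_pos hu _).le)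
    · have h : (0 : ℤ) < S.min' hne * (S.min' hne - 1) := by nlinarith
      have h' : (0 : ℝ) < (S.min' hne : ℝ) * ((S.min' hne - 1 : ℤ) : ℝ) := by exact_mod_cast h
      rw [← mul_assoc ((S.min' hne : ℤ) : ℝ)]
      exact mul_pos (hp _ (S.min'_mem hne)) (mul_pos h' (zpow_pos hu _))
  have hPpos : 0 < P τ := by
    rw [hP]
    exact Finset.sum_pos (fun j hj => mul_pos (hp j hj) (zpow_pos hτ _)) hne
  have hderiv : ∀ u : ℝ, 0 < u → HasDerivAt P (deriv P u) u :=
    fun u hu => (hd1 u hu).differentiableAt.hasDerivAt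
  have hmono' : StrictMonoOn (deriv P) (Set.Ioi 0) :=
    strictMonoOn_of_deriv_pos (convex_Ioi 0)
      (fun u hu => (hd2 u hu).continuousAt.continuousWithinAt)
      (fun u hu => hpos2 u (by simpa using hu))
  have hanti : StrictAntiOn P (Set.Ioc 0 τ) :=
    strictAntiOn_of_deriv_neg (convex_Ioc 0 τ)
      (fun u hu => (hderiv u hu.1).continuousAt.continuousWithinAt) (fun u hu => by
        rw [interior_Ioc] at hu
        exact (hmono' hu.1 hτ hu.2).trans_eq hτ')
  have hmono : StrictMonoOn P (Set.Ici τ) :=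
    strictMonoOn_of_deriv_pos (convex_Ici τ)
      (fun u hu => (hderiv u (hτ.trans_le hu)).continuousAt.continuousWithinAt) (fun u hu => by
        rw [interior_Ici] at hu
        exact hτ'.symm.trans_lt (hmono' hτ (hτ.trans hu) hu))
  have hmem : ∀ᶠ z in nhdsWithin ρ (Set.Ioo 0 ρ), z ∈ Set.Ioo 0 ρ := self_mem_nhdsWithin
  have hρpos : 0 < ρ := by rw [hρ]; positivity
  -- values of `P` above the minimum eventually exceed `1 / z`
  have hlt : ∀ y, P τ < y → ∀ᶠ z in nhdsWithin ρ (Set.Ioo 0 ρ), ∀ x, z * x = 1 → x < y := by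
    intro y hy
    have h1 : 1 / y < ρ := by rw [hρ]; exact one_div_lt_one_div_of_lt hPpos hy
    filter_upwards [hmem, (lt_mem_nhds h1).filter_mono nhdsWithin_le_nhds] with z hz hzy x hx
    rw [div_lt_iff₀ (hPpos.trans hy), ← hx] at hzy
    exact lt_of_mul_lt_mul_left hzy hz.1.le
  have hu : Tendsto u₁ (nhdsWithin ρ (Set.Ioo 0 ρ)) (nhdsWithin τ {τ}ᶜ) := by
    refine tendsto_nhdsWithin_iff.mpr ⟨tendsto_order.mpr ⟨fun a ha => ?_, fun b hb => ?_⟩, ?_⟩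
    · have hm : max a (τ / 2) ∈ Set.Ioc 0 τ :=
        ⟨lt_max_of_lt_right (by positivity), max_le ha.le (by linarith)⟩
      have hm' : max a (τ / 2) < τ := max_lt ha (by linarith)
      filter_upwards [hmem, hlt _ (hanti hm ⟨hτ, le_rfl⟩ hm')] with z hz h
      obtain ⟨h1, h2⟩ := hu₁ z hz
      exact (le_max_left _ _).trans_lt ((hanti.lt_iff_gt ⟨h1.1, h1.2.le⟩ hm).mp (h _ h2))
    · filter_upwards [hmem] with z hz using (hu₁ z hz).1.2.trans hb
    · filter_upwards [hmem] with z hz using (hu₁ z hz).1.2.ne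
  have hv : Tendsto v₁ (nhdsWithin ρ (Set.Ioo 0 ρ)) (nhdsWithin τ {τ}ᶜ) := by
    refine tendsto_nhdsWithin_iff.mpr ⟨tendsto_order.mpr ⟨fun a ha => ?_, fun b hb => ?_⟩, ?_⟩
    · filter_upwards [hmem] with z hz using ha.trans (hv₁ z hz).1
    · filter_upwards [hmem, hlt _ (hmono Set.self_mem_Ici hb.le hb)] with z hz h
      obtain ⟨h1, h2⟩ := hv₁ z hz
      exact (hmono.lt_iff_lt (Set.mem_Ici.mpr (le_of_lt h1)) hb.le).mp (h _ h2)
    · filter_upwards [hmem] with z hz using (ne_of_gt (hv₁ z hz).1)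
  have hf : ∀ᶠ x in nhds τ, HasDerivAt P (deriv P x) x := by
    filter_upwards [lt_mem_nhds hτ] with x hx using hderiv x hx
  have hf' := (hd2 τ hτ).differentiableAt.hasDerivAt
  have key := fun w hw hz => tendsto_abs_sub_div_sqrt_of_critical (w := w)
    (l := nhdsWithin ρ (Set.Ioo 0 ρ)) hf hτ' hf' (hpos2 τ hτ) hPpos hw hz
  rw [← hσ, ← hρ] at key
  constructor
  · refine (key u₁ hu (hmem.mono fun z hz => (hu₁ z hz).2)).congr' ?_
    filter_upwards [hmem] with z hz
    rw [abs_of_neg (sub_neg.mpr (hu₁ z hz).1.2), neg_sub]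
  · refine (key v₁ hv (hmem.mono fun z hz => (hv₁ z hz).2)).congr' ?_
    filter_upwards [hmem] with z hz
    rw [abs_of_pos (sub_pos.mpr (hv₁ z hz).1)]
end
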